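/- Let L be a frame, N a type, and β : N → L a family such that every φ ∈ L satisfies φ = sSup {b | ∃ n, b = β n ∧ b ≪ φ}. Define H : Set (Finset N) → L by H S = ⨆ ℓ ∈ S, ⨅ n ∈ ℓ, β n, and I : L → Set (Finset N) by I φ = {ℓ | ∃ n ∈ ℓ, β n ≪ φ}. Then (i) H (I φ) = φ for every φ ∈ L, and (ii) I preserves directed suprema: for every nonempty index type S and every directed family φ : S → L (for all s, t there is u with φ s ≤ φ u and φ t ≤ φ u), I (⨆ s, φ s) = ⋃ s, I (φ s). -/

import Mathlib

/-- `a` is way below `b` in a complete lattice: whenever `b ≤ sSup D` for a nonempty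
directed set `D`, already `a ≤ d` for some `d ∈ D`. -/
def wayBelow {L : Type*} [CompleteLattice L] (a b : L) : Prop :=
  ∀ D : Set L, D.Nonempty → DirectedOn (· ≤ ·) D → b ≤ sSup D → ∃ d ∈ D, a ≤ d

section WayBelow

variable {L : Type*} [CompleteLattice L] {a b c : L}

theorem wayBelow.le (h : wayBelow a b) : a ≤ b := by
  obtain ⟨d, rfl, hd⟩ := h {b} (Set.singleton_nonempty b) (directedOn_singleton b) (by simp)
  exact hd

theorem wayBelow.trans_le (h : wayBelow a b) (hbc : b ≤ c) : wayBelow a c :=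
  fun D hne hD hc => h D hne hD (hbc.trans hc)

theorem wayBelow.of_le (hab : a ≤ b) (h : wayBelow b c) : wayBelow a c := by
  intro D hne hD hc
  obtain ⟨d, hd, hbd⟩ := h D hne hD hc
  exact ⟨d, hd, hab.trans hbd⟩

theorem wayBelow_bot : wayBelow ⊥ a :=
  fun _ ⟨d, hd⟩ _ _ => ⟨d, hd, bot_le⟩

theorem wayBelow.sup (ha : wayBelow a c) (hb : wayBelow b c) : wayBelow (a ⊔ b) c := by
  intro D hne hD hc
  obtain ⟨d, hd, had⟩ := ha D hne hD hc
  obtain ⟨e, he, hbe⟩ := hb D hne hD hc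
  obtain ⟨f, hf, hdf, hef⟩ := hD d hd e he
  exact ⟨f, hf, sup_le (had.trans hdf) (hbe.trans hef)⟩

/-- In a continuous lattice, the elements way below a directed supremum are those way below
one of its terms. -/
theorem wayBelow_iSup_iff {S : Sort*} [Nonempty S] {φ : S → L}
    (hL : ∀ x : L, x ≤ sSup {y | wayBelow y x}) (hφ : Directed (· ≤ ·) φ) :
    wayBelow a (⨆ s, φ s) ↔ ∃ s, wayBelow a (φ s) := by
  refine ⟨fun h => ?_, fun ⟨s, hs⟩ => hs.trans_le (le_iSup φ s)⟩
  obtain ⟨d, ⟨s, hd⟩, had⟩ := h {d | ∃ s, wayBelow d (φ s)}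
    ⟨⊥, Classical.arbitrary S, wayBelow_bot⟩
    (by
      rintro d ⟨s, hd⟩ e ⟨t, he⟩
      obtain ⟨u, hsu, htu⟩ := hφ s t
      exact ⟨d ⊔ e, ⟨u, (hd.trans_le hsu).sup (he.trans_le htu)⟩, le_sup_left, le_sup_right⟩)
    (iSup_le fun s => (hL (φ s)).trans (sSup_le_sSup fun _ hy => ⟨s, hy⟩))
  exact ⟨s, wayBelow.of_le had hd⟩

end WayBelow

/-- Given an `N`-indexed basis `β` for a frame `L`, the frame homomorphism
`H S = ⨆ ℓ ∈ S, ⨅ n ∈ ℓ, β n` on sets of finite subsets of `N` splits the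
Scott-continuous map `I φ = {ℓ | ∃ n ∈ ℓ, β n ≪ φ}`:
`H ∘ I = id` and `I` preserves directed suprema. -/
theorem frame_basis_splitting {L : Type*} [Order.Frame L] {N : Type*} (β : N → L)
    (hbasis : ∀ φ : L, φ = sSup {b | ∃ n, b = β n ∧ wayBelow b φ}) :
    (∀ φ : L,
      (⨆ ℓ ∈ {ℓ : Finset N | ∃ n ∈ ℓ, wayBelow (β n) φ}, ⨅ n ∈ ℓ, β n) = φ) ∧
    (∀ (S : Type) (_ : Nonempty S) (φ : S → L),
      (∀ s t : S, ∃ u : S, φ s ≤ φ u ∧ φ t ≤ φ u) →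
      {ℓ : Finset N | ∃ n ∈ ℓ, wayBelow (β n) (⨆ s, φ s)} =
        ⋃ s : S, {ℓ : Finset N | ∃ n ∈ ℓ, wayBelow (β n) (φ s)}) := by
  refine ⟨fun φ => le_antisymm ?_ ?_, fun S _ φ hφ => ?_⟩
  · refine iSup₂_le fun ℓ hℓ => ?_
    obtain ⟨n, hn, hnφ⟩ := hℓ
    exact (iInf₂_le n hn).trans hnφ.le
  · conv_lhs => rw [hbasis φ]
    refine sSup_le ?_
    rintro _ ⟨n, rfl, hn⟩
    exact le_iSup₂_of_le {n} ⟨n, Finset.mem_singleton_self n, hn⟩ (by simp)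
  · have hL (x : L) : x ≤ sSup {y | wayBelow y x} := by
      conv_lhs => rw [hbasis x]
      refine sSup_le_sSup ?_
      rintro _ ⟨n, rfl, hn⟩
      exact hn
    ext ℓ
    simp only [Set.mem_ofPred_eq, Set.mem_iUnion, wayBelow_iSup_iff hL hφ]
    grind
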